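/- If S and X are compact, then WAP(X,ω) = C(X,ω): every f ∈ C(X,ω) is weighted weakly almost periodic. -/

import Mathlib

open scoped ENNReal
open BoundedContinuousFunction

/-- `ω` is a weight on `(X, mul)`: positive, submultiplicative, and `ω`, `ω⁻¹`
bounded on compact subsets. -/
def IsWeight {X : Type*} [TopologicalSpace X] (mul : X → X → X) (ω : X → ℝ) : Prop :=
  (∀ x, 0 < ω x) ∧ (∀ x y, ω (mul x y) ≤ ω x * ω y) ∧
  (∀ K : Set X, IsCompact K → ∃ M : ℝ, ∀ x ∈ K, ω x ≤ M) ∧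
  (∀ K : Set X, IsCompact K → ∃ m : ℝ, 0 < m ∧ ∀ x ∈ K, m ≤ ω x)

/-- `C(X, ω)`: continuous `f : X → ℝ` with `f/ω` bounded and continuous. -/
def Cw {X : Type*} [TopologicalSpace X] (ω : X → ℝ) : Set (X → ℝ) :=
  {f | Continuous f ∧ ∃ g : X →ᵇ ℝ, ∀ x, g x = f x / ω x}

/-- The set of weighted left translates `ₛ(f/ω)·ₛΩ`, where
`ₛΩ(x) = Ω(s•e, x) = ω((s•e)x)/(ω(s•e)ω(x))`, realized in `C_b(X)`. -/
def wTrans {S X : Type*} [TopologicalSpace X] (act : S → X → X) (mul : X → X → X)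
    (ω : X → ℝ) (e : X) (f : X → ℝ) : Set (X →ᵇ ℝ) :=
  {g | ∃ s : S, ∀ x, g x =
    (f (act s x) / ω (act s x)) * (ω (mul (act s e) x) / (ω (act s e) * ω x))}

/-- Weighted almost periodic functions: weighted left translates relatively
norm-compact in `C_b(X)`. -/
def APw {S X : Type*} [TopologicalSpace X] (act : S → X → X) (mul : X → X → X)
    (ω : X → ℝ) (e : X) : Set (X → ℝ) :=
  {f | f ∈ Cw ω ∧ IsCompact (closure (wTrans act mul ω e f))}

/-- Weighted weakly almost periodic functions: weighted left translates
relatively compact in the weak topology of `C_b(X)`. -/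
def WAPw {S X : Type*} [TopologicalSpace X] (act : S → X → X) (mul : X → X → X)
    (ω : X → ℝ) (e : X) : Set (X → ℝ) :=
  {f | f ∈ Cw ω ∧
    IsCompact (closure ((toWeakSpace ℝ (X →ᵇ ℝ)) '' wTrans act mul ω e f))}

/-- Weighted left uniformly continuous functions: `s ↦ ₛ(f/ω)·ₛΩ` is norm
continuous from `S` into `C_b(X)`. -/
def LUCw {S X : Type*} [TopologicalSpace S] [TopologicalSpace X] (act : S → X → X)
    (mul : X → X → X) (ω : X → ℝ) (e : X) : Set (X → ℝ) :=
  {f | f ∈ Cw ω ∧ ∃ T : S → (X →ᵇ ℝ), Continuous T ∧ ∀ s x, T s x =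
    (f (act s x) / ω (act s x)) * (ω (mul (act s e) x) / (ω (act s e) * ω x))}

/-- Weighted right uniformly continuous functions: `x ↦ (f/ω)(·x)·Ω(·e,x)` is
norm continuous from `X` into `C_b(S)`. -/
def RUCw {S X : Type*} [TopologicalSpace S] [TopologicalSpace X] (act : S → X → X)
    (mul : X → X → X) (ω : X → ℝ) (e : X) : Set (X → ℝ) :=
  {f | f ∈ Cw ω ∧ ∃ U : X → (S →ᵇ ℝ), Continuous U ∧ ∀ x s, U x s =
    (f (act s x) / ω (act s x)) * (ω (mul (act s e) x) / (ω (act s e) * ω x))}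

open Filter Topology

section VariationFunctional

variable {X : Type*} [TopologicalSpace X]

/-- The total variation of a functional `φ`, evaluated at a nonnegative function `g`:
the supremum of `φ h` over all `h` with `|h| ≤ g`. -/
noncomputable def variationFunctional (φ : (X →ᵇ ℝ) →L[ℝ] ℝ) (g : X →ᵇ ℝ) : ℝ :=
  sSup (φ '' {h | |h| ≤ g})

lemma norm_le_norm_of_forall_abs_le {h g : X →ᵇ ℝ} (hg : |h| ≤ g) : ‖h‖ ≤ ‖g‖ := by
  refine (BoundedContinuousFunction.norm_le (norm_nonneg g)).2 fun x => ?_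
  have h1 : |h x| ≤ g x := hg x
  exact h1.trans ((le_abs_self _).trans (g.norm_coe_le_norm x))

lemma variationFunctional_upper_bound (φ : (X →ᵇ ℝ) →L[ℝ] ℝ) {h g : X →ᵇ ℝ} (hg : |h| ≤ g) :
    φ h ≤ ‖φ‖ * ‖g‖ :=
  calc φ h ≤ ‖φ h‖ := le_abs_self _
    _ ≤ ‖φ‖ * ‖h‖ := φ.le_opNorm h
    _ ≤ ‖φ‖ * ‖g‖ :=
      mul_le_mul_of_nonneg_left (norm_le_norm_of_forall_abs_le hg) φ.opNorm_nonneg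

lemma le_variationFunctional (φ : (X →ᵇ ℝ) →L[ℝ] ℝ) {h g : X →ᵇ ℝ} (hg : |h| ≤ g) :
    φ h ≤ variationFunctional φ g := by
  refine le_csSup ⟨‖φ‖ * ‖g‖, ?_⟩ ⟨h, hg, rfl⟩
  rintro _ ⟨k, hk, rfl⟩
  exact variationFunctional_upper_bound φ hk

lemma variationFunctional_le (φ : (X →ᵇ ℝ) →L[ℝ] ℝ) {g : X →ᵇ ℝ} (hg : 0 ≤ g) {c : ℝ}
    (hc : ∀ h, |h| ≤ g → φ h ≤ c) : variationFunctional φ g ≤ c := by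
  refine csSup_le ⟨φ 0, 0, by simpa using hg, rfl⟩ ?_
  rintro _ ⟨k, hk, rfl⟩
  exact hc k hk

lemma variationFunctional_nonneg (φ : (X →ᵇ ℝ) →L[ℝ] ℝ) {g : X →ᵇ ℝ} (hg : 0 ≤ g) :
    0 ≤ variationFunctional φ g := by
  have h0 : |(0 : X →ᵇ ℝ)| ≤ g := by simpa using hg
  simpa using le_variationFunctional φ h0

lemma variationFunctional_le_norm (φ : (X →ᵇ ℝ) →L[ℝ] ℝ) {g : X →ᵇ ℝ} (hg : 0 ≤ g) :
    variationFunctional φ g ≤ ‖φ‖ * ‖g‖ :=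
  variationFunctional_le φ hg fun _ hh => variationFunctional_upper_bound φ hh

lemma abs_le_variationFunctional_abs (φ : (X →ᵇ ℝ) →L[ℝ] ℝ) (g : X →ᵇ ℝ) :
    |φ g| ≤ variationFunctional φ |g| := by
  refine abs_le'.2 ⟨le_variationFunctional φ le_rfl, ?_⟩
  rw [← map_neg]
  exact le_variationFunctional φ (abs_neg g).le

lemma variationFunctional_add (φ : (X →ᵇ ℝ) →L[ℝ] ℝ) {a b : X →ᵇ ℝ} (ha : 0 ≤ a) (hb : 0 ≤ b) :
    variationFunctional φ (a + b) = variationFunctional φ a + variationFunctional φ b := by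
  apply le_antisymm
  · refine variationFunctional_le φ (add_nonneg ha hb) fun h hh => ?_
    have h1 : |(h ⊓ a) ⊔ (-a)| ≤ a := by
      intro x
      have hax : 0 ≤ a x := ha x
      change |max (min (h x) (a x)) (-(a x))| ≤ a x
      exact abs_le.2 ⟨le_max_right _ _, max_le (min_le_right _ _) (by linarith)⟩
    have h2 : |h - (h ⊓ a) ⊔ (-a)| ≤ b := by
      intro x
      have hax : 0 ≤ a x := ha x
      have hbx : 0 ≤ b x := hb x
      have hhx : |h x| ≤ a x + b x := hh x
      change |h x - max (min (h x) (a x)) (-(a x))| ≤ b x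
      rw [abs_le] at hhx ⊢
      rcases min_cases (h x) (a x) with h3 | h3 <;>
        rcases max_cases (min (h x) (a x)) (-(a x)) with h4 | h4 <;>
        constructor <;> linarith
    calc φ h = φ ((h ⊓ a) ⊔ (-a)) + φ (h - (h ⊓ a) ⊔ (-a)) := by rw [← map_add]; congr 1; abel
      _ ≤ _ := add_le_add (le_variationFunctional φ h1) (le_variationFunctional φ h2)
  · suffices variationFunctional φ a ≤ variationFunctional φ (a + b) - variationFunctional φ b by
      linarith
    refine variationFunctional_le φ ha fun h hh => ?_
    suffices variationFunctional φ b ≤ variationFunctional φ (a + b) - φ h by linarith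
    refine variationFunctional_le φ hb fun k hk => ?_
    have h1 : |h + k| ≤ a + b := (abs_add_le h k).trans (add_le_add hh hk)
    have h2 := le_variationFunctional φ h1
    rw [map_add] at h2
    linarith

lemma variationFunctional_mono (φ : (X →ᵇ ℝ) →L[ℝ] ℝ) {a b : X →ᵇ ℝ} (ha : 0 ≤ a) (hab : a ≤ b) :
    variationFunctional φ a ≤ variationFunctional φ b := by
  have h1 := variationFunctional_add φ ha (sub_nonneg.2 hab)
  rw [add_sub_cancel] at h1
  linarith [variationFunctional_nonneg φ (sub_nonneg.2 hab)]

end VariationFunctional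

section BoundedConvergence

variable {X : Type*} [TopologicalSpace X] [CompactSpace X]

/-- Running infima of a sequence. -/
def runningInf {α : Type*} [Lattice α] (A : ℕ → α) : ℕ → α
  | 0 => A 0
  | n + 1 => runningInf A n ⊓ A (n + 1)

lemma runningInf_le {α : Type*} [Lattice α] (A : ℕ → α) : ∀ n, runningInf A n ≤ A n
  | 0 => le_rfl
  | _ + 1 => inf_le_right

lemma le_runningInf {α : Type*} [Lattice α] {A : ℕ → α} {c : α} (h : ∀ n, c ≤ A n) :
    ∀ n, c ≤ runningInf A n
  | 0 => h 0
  | n + 1 => le_inf (le_runningInf h n) (h (n + 1))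

/-- Dini's theorem for a decreasing sequence of bounded continuous functions. -/
lemma exists_norm_lt_of_antitone {H : ℕ → X →ᵇ ℝ} (hH : Antitone H)
    (hlim : ∀ x, Tendsto (fun n => H n x) atTop (𝓝 0)) {δ : ℝ} (hδ : 0 < δ) :
    ∃ n, ‖H n‖ < δ := by
  have hu : TendstoUniformly (fun n x => H n x) (fun _ : X => (0 : ℝ)) atTop :=
    Antitone.tendstoUniformly_of_forall_tendsto (fun n => (H n).continuous)
      (fun m n hmn x => hH hmn x) continuous_const hlim
  obtain ⟨n, hn⟩ := (Metric.tendstoUniformly_iff.1 hu (δ / 2) (half_pos hδ)).exists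
  refine ⟨n, lt_of_le_of_lt ?_ (half_lt_self hδ)⟩
  refine (BoundedContinuousFunction.norm_le (half_pos hδ).le).2 fun x => ?_
  have := hn x
  rw [dist_comm, dist_zero_right] at this
  exact this.le

/-- Bounded convergence for the variation of a functional on continuous functions. -/
lemma exists_variationFunctional_lt (φ : (X →ᵇ ℝ) →L[ℝ] ℝ) {g : ℕ → X →ᵇ ℝ} {C : ℝ}
    (hg0 : ∀ n, 0 ≤ g n) (hgC : ∀ n x, g n x ≤ C)
    (hlim : ∀ x, Tendsto (fun n => g n x) atTop (𝓝 0)) {ε : ℝ} (hε : 0 < ε) :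
    ∃ n, variationFunctional φ (g n) < ε := by
  by_contra! hcon
  set G : ℕ → ℕ → X →ᵇ ℝ := fun n j => partialSups (fun i => g (n + i)) j with hG
  have hgG : ∀ n m, n ≤ m → ∀ j, m - n ≤ j → g m ≤ G n j := fun n m hnm j hj => by
    have h1 := le_partialSups_of_le (fun i => g (n + i)) hj
    rwa [Nat.add_sub_cancel' hnm] at h1
  have hG0 : ∀ n j, 0 ≤ G n j := fun n j => (hg0 n).trans (hgG n n le_rfl j (by simp))
  have hGle : ∀ n j x c, (∀ i, n ≤ i → g i x ≤ c) → G n j x ≤ c := by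
    intro n j x c hc
    induction j with
    | zero => simpa [hG] using hc n le_rfl
    | succ j ih =>
      simp only [hG, partialSups_add_one] at ih ⊢
      exact max_le ih (hc _ (by omega))
  have hGmono : ∀ n, Monotone (G n) := fun n => (partialSups (fun i => g (n + i))).monotone
  have hbdd : ∀ n, BddAbove (Set.range fun j => variationFunctional φ (G n j)) := by
    intro n
    refine ⟨‖φ‖ * |C|, ?_⟩
    rintro _ ⟨j, rfl⟩
    refine (variationFunctional_le_norm φ (hG0 n j)).trans
      (mul_le_mul_of_nonneg_left ?_ φ.opNorm_nonneg)
    refine (BoundedContinuousFunction.norm_le (abs_nonneg C)).2 fun x => ?_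
    have h1 : 0 ≤ G n j x := hG0 n j x
    rw [Real.norm_eq_abs, abs_of_nonneg h1]
    exact (hGle n j x C fun i _ => hgC i x).trans (le_abs_self C)
  have hj : ∀ n, ∃ j, ∀ i, variationFunctional φ (G n i) ≤
      variationFunctional φ (G n j) + ε / 4 * (1 / 2) ^ n := by
    intro n
    have hpos : 0 < ε / 4 * (1 / 2) ^ n := by positivity
    obtain ⟨j, hj⟩ := exists_lt_of_lt_ciSup
      (sub_lt_self (⨆ j, variationFunctional φ (G n j)) hpos)
    exact ⟨j, fun i => by linarith [le_ciSup (hbdd n) i]⟩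
  choose j hj using hj
  set A : ℕ → X →ᵇ ℝ := fun n => G n (j n)
  have hA0 : ∀ n, 0 ≤ A n := fun n => hG0 n (j n)
  have hH0 : ∀ n, 0 ≤ runningInf A n := le_runningInf hA0
  have key : ∀ n, variationFunctional φ (A n) - ε / 2 * (1 - (1 / 2) ^ n) ≤
      variationFunctional φ (runningInf A n) := by
    intro n
    induction n with
    | zero => simp [runningInf]
    | succ n ih =>
      have h1 : variationFunctional φ (runningInf A n ⊓ A (n + 1)) +
          variationFunctional φ (runningInf A n ⊔ A (n + 1)) =
          variationFunctional φ (runningInf A n) + variationFunctional φ (A (n + 1)) := by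
        rw [← variationFunctional_add φ (le_inf (hH0 n) (hA0 _)) ((hH0 n).trans le_sup_left),
          ← variationFunctional_add φ (hH0 n) (hA0 _), inf_add_sup]
      have h2 : runningInf A n ⊔ A (n + 1) ≤ G n (max (j n) (j (n + 1) + 1)) := by
        refine sup_le ((runningInf_le A n).trans (hGmono n (le_max_left _ _))) ?_
        refine partialSups_le _ _ _ fun i hi => ?_
        refine hgG n (n + 1 + i) (by omega) _ (le_max_of_le_right (by omega))
      have h3 := variationFunctional_mono φ ((hH0 n).trans le_sup_left) h2
      have h4 := hj n (max (j n) (j (n + 1) + 1))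
      change _ ≤ variationFunctional φ (runningInf A n ⊓ A (n + 1))
      change _ ≤ variationFunctional φ (A n) + _ at h4
      rw [pow_succ]
      linarith
  have hanti : Antitone (runningInf A) := antitone_nat_of_succ_le fun n => inf_le_left
  have hHlim : ∀ x, Tendsto (fun n => runningInf A n x) atTop (𝓝 0) := by
    intro x
    rw [Metric.tendsto_atTop]
    intro δ hδ
    obtain ⟨N, hN⟩ := Metric.tendsto_atTop.1 (hlim x) (δ / 2) (half_pos hδ)
    refine ⟨N, fun n hn => ?_⟩
    have h0 : 0 ≤ runningInf A n x := hH0 n x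
    have h1 : runningInf A n x ≤ A n x := runningInf_le A n x
    have h2 : A n x ≤ δ / 2 := hGle n (j n) x _ fun i hi => by
      have := hN i (hn.trans hi)
      rw [dist_zero_right] at this
      exact (le_abs_self _).trans this.le
    rw [dist_zero_right, Real.norm_eq_abs, abs_of_nonneg h0]
    linarith
  obtain ⟨n, hn⟩ := exists_norm_lt_of_antitone hanti hHlim
    (show 0 < ε / 2 / (‖φ‖ + 1) by positivity)
  have h1 := variationFunctional_le_norm φ (hH0 n)
  have h2 : ‖φ‖ * ‖runningInf A n‖ < ε / 2 := by
    rw [lt_div_iff₀ (by positivity)] at hn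
    nlinarith [norm_nonneg (runningInf A n)]
  have h3 : ε ≤ variationFunctional φ (A n) :=
    (hcon n).trans (variationFunctional_mono φ (hg0 n) (hgG n n le_rfl _ (by simp)))
  have h4 : 0 ≤ ε / 2 * (1 / 2) ^ n := by positivity
  linarith [key n]

end BoundedConvergence

section Grothendieck

variable {S X : Type*} [TopologicalSpace S] [CompactSpace S] [TopologicalSpace X] [CompactSpace X]

lemma exists_finset_approx {ι : Type*} (T : ι → X →ᵇ ℝ) (G : Finset ι) {δ : ℝ} (hδ : 0 < δ) :
    ∃ F : Finset X, ∀ x, ∃ z ∈ F, ∀ s ∈ G, |T s x - T s z| < δ := by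
  obtain ⟨F, hF⟩ := CompactSpace.elim_nhds_subcover
    (fun z => {x | ∀ s ∈ G, |T s x - T s z| < δ}) fun z => by
      refine (Filter.eventually_all_finset G).2 fun s _ => ?_
      exact Metric.tendsto_nhds.1 ((T s).continuous.tendsto z) δ hδ
  refine ⟨F, fun x => ?_⟩
  have hx : x ∈ ⋃ z ∈ F, {x | ∀ s ∈ G, |T s x - T s z| < δ} := by rw [hF]; trivial
  simpa using hx

/-- A point in the pointwise closure of a subset of a pointwise compact family of continuous
functions on a compact space is the pointwise limit of a sequence in that subset. -/
lemma exists_seq_tendsto_of_frequently (T : S → X →ᵇ ℝ) (hT : ∀ x, Continuous fun s => T s x)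
    {s₀ : S} {P : S → Prop} (hP : ∃ᶠ s in 𝓝 s₀, P s) :
    ∃ u : ℕ → S, (∀ n, P (u n)) ∧ ∀ x, Tendsto (fun n => T (u n) x) atTop (𝓝 (T s₀ x)) := by
  classical
  have hnet : ∀ (G : Finset S) (N : ℕ), ∃ F : Finset X, ∀ x, ∃ z ∈ F, ∀ s ∈ insert s₀ G,
      |T s x - T s z| < 1 / ((N : ℝ) + 1) := fun G N =>
    exists_finset_approx T _ Nat.one_div_pos_of_nat
  choose net hnet using hnet
  obtain ⟨y, hyP, hyr⟩ := exists_seq_of_forall_finset_exists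
    (fun y : Finset S × ℕ × S => P y.2.2)
    (fun x y => x.2.2 ∈ y.1 ∧ x.2.1 < y.2.1 ∧
      ∀ z ∈ net x.1 x.2.1, |T y.2.2 z - T s₀ z| < 1 / ((y.2.1 : ℝ) + 1)) (by
    intro Y _
    set N := Y.sup (fun x => x.2.1) + 1
    have hev : ∀ᶠ s in 𝓝 s₀, ∀ x ∈ Y, ∀ z ∈ net x.1 x.2.1,
        |T s z - T s₀ z| < 1 / ((N : ℝ) + 1) := by
      refine (Filter.eventually_all_finset Y).2 fun x _ =>
        (Filter.eventually_all_finset _).2 fun z _ => ?_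
      exact Metric.tendsto_nhds.1 ((hT z).tendsto s₀) _ Nat.one_div_pos_of_nat
    obtain ⟨s, hs, hs'⟩ := (hP.and_eventually hev).exists
    refine ⟨(Y.image fun x => x.2.2, N, s), hs, fun x hx => ⟨?_, ?_, hs' x hx⟩⟩
    · exact Finset.mem_image_of_mem _ hx
    · exact Nat.lt_succ_of_le (Finset.le_sup (f := fun x : Finset S × ℕ × S => x.2.1) hx))
  have hmono : StrictMono fun n => (y n).2.1 := fun m n hmn => (hyr m n hmn).2.1
  have hsmall : Tendsto (fun n => 1 / (((y n).2.1 : ℝ) + 1)) atTop (𝓝 0) :=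
    tendsto_one_div_add_atTop_nhds_zero_nat.comp hmono.tendsto_atTop
  refine ⟨fun n => (y n).2.2, hyP, fun x => ?_⟩
  rw [tendsto_iff_ultrafilter]
  intro U hU
  choose z hzmem hz using fun n => hnet (y n).1 (y n).2.1 x
  obtain ⟨s', hs'⟩ : ∃ s', Tendsto (fun n => (y n).2.2) U (𝓝 s') :=
    ⟨_, (U.map fun n => (y n).2.2).le_nhds_lim⟩
  obtain ⟨x', hx'⟩ : ∃ x', Tendsto z U (𝓝 x') := ⟨_, (U.map z).le_nhds_lim⟩
  have hlim : ∀ s, (∀ᶠ n in atTop, s ∈ insert s₀ (y n).1) → T s x = T s x' := by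
    intro s hs
    have h1 : Tendsto (fun n => T s (z n)) U (𝓝 (T s x')) := ((T s).continuous.tendsto x').comp hx'
    have h2 : Tendsto (fun n => T s x - T s (z n)) atTop (𝓝 0) :=
      squeeze_zero_norm' (hs.mono fun n hn => (hz n s hn).le) hsmall
    have h3 := (h2.mono_left hU)
    have h4 := tendsto_nhds_unique h3 (h1.const_sub (T s x))
    linarith
  have h0 : T s₀ x = T s₀ x' := hlim s₀ (Eventually.of_forall fun n => Finset.mem_insert_self _ _)
  have hi : ∀ i, T (y i).2.2 x = T (y i).2.2 x' := fun i =>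
    hlim _ ((eventually_gt_atTop i).mono fun n hn => Finset.mem_insert_of_mem (hyr i n hn).1)
  have hc : ∀ w, Tendsto (fun n => T (y n).2.2 w) U (𝓝 (T s' w)) := fun w =>
    ((hT w).tendsto s').comp hs'
  have h1 : T s' x = T s' x' := by
    refine tendsto_nhds_unique (hc x) ?_
    simpa only [hi] using hc x'
  have h2 : ∀ n, T s' (z n) = T s₀ (z n) := by
    intro n
    have h3 : Tendsto (fun m => T (y m).2.2 (z n) - T s₀ (z n)) atTop (𝓝 0) :=
      squeeze_zero_norm' ((eventually_gt_atTop n).mono fun m hm =>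
        ((hyr n m hm).2.2 _ (hzmem n)).le) hsmall
    have h4 := tendsto_nhds_unique (h3.mono_left hU) ((hc (z n)).sub_const _)
    linarith
  have h5 : T s' x' = T s₀ x' := by
    refine tendsto_nhds_unique (((T s').continuous.tendsto x').comp hx') ?_
    refine (((T s₀).continuous.tendsto x').comp hx').congr fun n => (h2 n).symm
  have h6 := hc x
  rwa [h1, h5, ← h0] at h6

/-- **Grothendieck's theorem**: a bounded, pointwise continuous map from a compact space into the
continuous functions on a compact space is weakly continuous. -/
theorem continuous_toWeakSpace_of_pointwise (T : S → X →ᵇ ℝ) (hT : ∀ x, Continuous fun s => T s x)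
    {C : ℝ} (hC : ∀ s x, |T s x| ≤ C) : Continuous fun s => toWeakSpace ℝ (X →ᵇ ℝ) (T s) := by
  refine WeakBilin.continuous_of_continuous_eval _ fun φ => ?_
  change Continuous fun s => φ (T s)
  refine continuous_iff_continuousAt.2 fun s₀ => Metric.tendsto_nhds.2 fun ε hε => ?_
  by_contra hcon
  obtain ⟨u, hu, hlim⟩ := exists_seq_tendsto_of_frequently T hT (Filter.not_eventually.1 hcon)
  obtain ⟨n, hn⟩ := exists_variationFunctional_lt φ (g := fun n => |T (u n) - T s₀|) (C := C + C)
    (fun n => abs_nonneg _) (fun n x => (abs_sub _ _).trans (add_le_add (hC _ x) (hC _ x)))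
    (fun x => by simpa using ((hlim x).sub_const (T s₀ x)).abs) hε
  refine hu n (lt_of_le_of_lt ?_ hn)
  rw [Real.dist_eq, ← map_sub]
  exact abs_le_variationFunctional_abs φ _

end Grothendieck

/-- if `S` and `X` are compact, then `WAP(X,ω) = C(X,ω)`. -/
theorem stmt4 {S X : Type*} [TopologicalSpace S] [TopologicalSpace X]
    [CompactSpace S] [CompactSpace X]
    (act : S → X → X) (mul : X → X → X) (ω : X → ℝ) (e : X)
    (hω : IsWeight mul ω) (hωc : Continuous ω)
    (he : ∀ x, mul e x = x ∧ mul x e = x)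
    (hacts : ∀ s, Continuous (act s)) (hactx : ∀ x, Continuous fun s => act s x)
    (hmuls : ∀ x : X, Continuous (mul x)) (hmulx : ∀ y : X, Continuous fun x => mul x y) :
    WAPw act mul ω e = Cw ω := by
  refine Set.Subset.antisymm (fun f hf => hf.1) fun f hf => ⟨hf, ?_⟩
  obtain ⟨hpos, hsub, -, -⟩ := hω
  obtain ⟨hfc, g, hg⟩ := hf
  have hne : ∀ x, ω x ≠ 0 := fun x => (hpos x).ne'
  have hcont : ∀ s, Continuous fun x =>
      (f (act s x) / ω (act s x)) * (ω (mul (act s e) x) / (ω (act s e) * ω x)) := fun s =>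
    ((hfc.comp (hacts s)).div (hωc.comp (hacts s)) fun _ => hne _).mul
      ((hωc.comp (hmuls _)).div (continuous_const.mul hωc) fun _ => mul_ne_zero (hne _) (hne _))
  let T : S → X →ᵇ ℝ := fun s => BoundedContinuousFunction.mkOfCompact ⟨_, hcont s⟩
  have hT : ∀ x, Continuous fun s => T s x := fun x =>
    ((hfc.comp (hactx x)).div (hωc.comp (hactx x)) fun _ => hne _).mul
      ((hωc.comp ((hmulx x).comp (hactx e))).div
        ((hωc.comp (hactx e)).mul continuous_const) fun _ => mul_ne_zero (hne _) (hne _))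
  have hC : ∀ s x, |T s x| ≤ ‖g‖ := by
    intro s x
    change |(f (act s x) / ω (act s x)) * (ω (mul (act s e) x) / (ω (act s e) * ω x))| ≤ ‖g‖
    have h1 : 0 < ω (act s e) * ω x := mul_pos (hpos _) (hpos _)
    rw [abs_mul, ← hg, abs_of_pos (div_pos (hpos (mul (act s e) x)) h1)]
    exact (mul_le_of_le_one_right (abs_nonneg _) ((div_le_one h1).2 (hsub _ _))).trans
      (g.norm_coe_le_norm _)
  have hrange : wTrans act mul ω e f = Set.range T := by
    ext h
    constructor
    · rintro ⟨s, hs⟩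
      exact ⟨s, BoundedContinuousFunction.ext fun x => (hs x).symm⟩
    · rintro ⟨s, rfl⟩
      exact ⟨s, fun x => rfl⟩
  rw [hrange, ← Set.range_comp]
  exact (isCompact_range (continuous_toWeakSpace_of_pointwise T hT hC)).closure
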